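/- Let τ > 0 and let α : ℝ → ℝ be continuous and τ-periodic with ∫_0^τ α(u) du > 0. Let ω : ℝ → ℝ be continuous with |ω(r)| ≤ C(1 + |r|) for all r ∈ ℝ, for some constant C ≥ 0. Define e(r,s) := exp(−∫_r^s α(u) du), S(s, ω) := ω(s) − ∫_{−∞}^{s} α(r) e(r,s) ω(r) dr, and for t ≥ t₀ and x ∈ ℝ define X(t, t₀, ω, x) := x·e(t₀,t) + ω(t) − e(t₀,t)·ω(t₀) − ∫_{t₀}^{t} α(r) e(r,t) ω(r) dr. Then for all t ≥ t₀, X(t, t₀, ω, S(t₀, ω)) = S(t, ω); that is, S is invariant under the flow X. -/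

import Mathlib

open MeasureTheory

/-- `e(r,s) = exp(-∫_r^s α(u) du)`. -/
noncomputable def expFactor (α : ℝ → ℝ) (r s : ℝ) : ℝ :=
  Real.exp (-(∫ u in r..s, α u))

/-- The pathwise random periodic solution
`S(s,ω) = ω(s) - ∫_{-∞}^s α(r) e(r,s) ω(r) dr`. -/
noncomputable def pathwiseRPS (α : ℝ → ℝ) (s : ℝ) (ω : ℝ → ℝ) : ℝ :=
  ω s - ∫ r in Set.Iic s, α r * expFactor α r s * ω r

/-- The pathwise solution flow of `dX = -α(t) X dt + dW_t`:
`X(t,t₀,ω,x) = x e(t₀,t) + ω(t) - e(t₀,t) ω(t₀) - ∫_{t₀}^t α(r) e(r,t) ω(r) dr`. -/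
noncomputable def pathwiseFlow (α : ℝ → ℝ) (t t₀ : ℝ) (ω : ℝ → ℝ) (x : ℝ) : ℝ :=
  x * expFactor α t₀ t + ω t - expFactor α t₀ t * ω t₀
    - ∫ r in t₀..t, α r * expFactor α r t * ω r

theorem expFactor_mul {α : ℝ → ℝ} (hα : Continuous α) (r s t : ℝ) :
    expFactor α r s * expFactor α s t = expFactor α r t := by
  simp only [expFactor]
  rw [← Real.exp_add, ← neg_add, intervalIntegral.integral_add_adjacent_intervals
    (hα.intervalIntegrable r s) (hα.intervalIntegrable s t)]

theorem continuous_expFactor_left {α : ℝ → ℝ} (hα : Continuous α) (s : ℝ) :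
    Continuous fun r => expFactor α r s := by
  have h : Continuous fun r => ∫ u in s..r, α u :=
    intervalIntegral.continuous_primitive (fun a b => hα.intervalIntegrable a b) s
  simpa only [expFactor, intervalIntegral.integral_symm s, neg_neg] using h.rexp

/-- The primitive of a continuous periodic function differs from a linear function, with slope
the mean value, by a bounded function. -/
theorem exists_abs_integral_sub_mean_mul_le {α : ℝ → ℝ} (hα : Continuous α) {τ : ℝ} (hτ : 0 < τ)
    (hper : Function.Periodic α τ) :
    ∃ B : ℝ, ∀ r s : ℝ, |(∫ u in r..s, α u) - (∫ u in (0 : ℝ)..τ, α u) / τ * (s - r)| ≤ B := by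
  set c := (∫ u in (0 : ℝ)..τ, α u) / τ with hc
  have hI : ∀ a b, IntervalIntegrable α volume a b := fun a b => hα.intervalIntegrable a b
  set G : ℝ → ℝ := fun t => (∫ u in (0 : ℝ)..t, α u) - c * t with hG
  have hGper : Function.Periodic G τ := fun t => by
    have hadd := hper.intervalIntegral_add_eq_add 0 t hI
    have hcτ : c * τ = ∫ u in (0 : ℝ)..τ, α u := div_mul_cancel₀ _ hτ.ne'
    simp only [zero_add] at hadd
    simp only [hG]
    linarith
  have hGcont : Continuous G :=
    (intervalIntegral.continuous_primitive hI 0).sub (continuous_const.mul continuous_id)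
  obtain ⟨B, hB⟩ := Metric.isBounded_iff.1 (hGper.isBounded_of_continuous hτ.ne' hGcont)
  refine ⟨B, fun r s => ?_⟩
  have h := hB (Set.mem_range_self s) (Set.mem_range_self r)
  rw [Real.dist_eq] at h
  convert h using 2
  have := intervalIntegral.integral_interval_sub_left (hI 0 s) (hI 0 r)
  simp only [hG]
  linarith

theorem exists_expFactor_le {α : ℝ → ℝ} (hα : Continuous α) {τ : ℝ} (hτ : 0 < τ)
    (hper : Function.Periodic α τ) (hmean : 0 < ∫ u in (0 : ℝ)..τ, α u) :
    ∃ K c : ℝ, 0 < c ∧ ∀ r s : ℝ, expFactor α r s ≤ K * Real.exp (-(c * (s - r))) := by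
  obtain ⟨B, hB⟩ := exists_abs_integral_sub_mean_mul_le hα hτ hper
  refine ⟨Real.exp B, _, div_pos hmean hτ, fun r s => ?_⟩
  rw [expFactor, ← Real.exp_add]
  have := (abs_le.1 (hB r s)).1
  exact Real.exp_le_exp.2 (by linarith)

theorem one_add_abs_le_mul_exp {d s r : ℝ} (hd : 0 < d) (hr : r ≤ s) :
    1 + |r| ≤ (1 + 1 / d) * Real.exp (d * (2 * |s| - r)) := by
  have hrs : |r| ≤ 2 * |s| - r := by
    rcases abs_cases r with h | h <;> rcases abs_cases s with h' | h' <;> linarith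
  set y := 2 * |s| - r
  have hy : 0 ≤ y := (abs_nonneg r).trans hrs
  have h1 : 1 ≤ Real.exp (d * y) := Real.one_le_exp (by positivity)
  have h2 : d * y ≤ Real.exp (d * y) := by linarith [Real.add_one_le_exp (d * y)]
  have h3 : y ≤ 1 / d * Real.exp (d * y) := by
    rw [one_div_mul_eq_div, le_div_iff₀ hd]
    linarith
  linarith

theorem integrableOn_mul_expFactor_mul {α : ℝ → ℝ} (hα : Continuous α) {τ : ℝ} (hτ : 0 < τ)
    (hper : Function.Periodic α τ) (hmean : 0 < ∫ u in (0 : ℝ)..τ, α u)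
    {ω : ℝ → ℝ} (hω : Continuous ω) {C : ℝ} (hgrow : ∀ r : ℝ, |ω r| ≤ C * (1 + |r|)) (s : ℝ) :
    IntegrableOn (fun r => α r * expFactor α r s * ω r) (Set.Iic s) := by
  obtain ⟨A, hA⟩ := (hper.isBounded_of_continuous hτ.ne' hα).exists_norm_le
  obtain ⟨K, c, hc, hK⟩ := exists_expFactor_le hα hτ hper hmean
  have hC : 0 ≤ C := by simpa using (abs_nonneg _).trans (hgrow 0)
  have hA0 : 0 ≤ A := (norm_nonneg _).trans (hA _ (Set.mem_range_self 0))
  have hint := (integrableOn_exp_mul_Iic (half_pos hc) s).const_mul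
    (A * K * C * (1 + 1 / (c / 2)) * Real.exp (c * |s| - c * s))
  refine Integrable.mono' hint
    ((hα.mul (continuous_expFactor_left hα s)).mul hω).aestronglyMeasurable ?_
  refine (ae_restrict_iff' measurableSet_Iic).2 (Filter.Eventually.of_forall fun r hr => ?_)
  have he : 0 ≤ expFactor α r s := (Real.exp_pos _).le
  have hω' : |ω r| ≤ C * ((1 + 1 / (c / 2)) * Real.exp (c / 2 * (2 * |s| - r))) :=
    (hgrow r).trans (mul_le_mul_of_nonneg_left (one_add_abs_le_mul_exp (half_pos hc) hr) hC)
  rw [norm_mul, norm_mul, Real.norm_of_nonneg he, Real.norm_eq_abs (ω r)]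
  calc ‖α r‖ * expFactor α r s * |ω r|
      ≤ A * (K * Real.exp (-(c * (s - r)))) *
          (C * ((1 + 1 / (c / 2)) * Real.exp (c / 2 * (2 * |s| - r)))) :=
        mul_le_mul (mul_le_mul (hA _ (Set.mem_range_self r)) (hK r s) he hA0) hω' (abs_nonneg _)
          (mul_nonneg hA0 (he.trans (hK r s)))
    _ = A * K * C * (1 + 1 / (c / 2)) *
          (Real.exp (-(c * (s - r))) * Real.exp (c / 2 * (2 * |s| - r))) := by ring
    _ = A * K * C * (1 + 1 / (c / 2)) *
          (Real.exp (c * |s| - c * s) * Real.exp (c / 2 * r)) := by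
        rw [← Real.exp_add, ← Real.exp_add]
        ring_nf
    _ = _ := by ring

/-- the pathwise random periodic solution is invariant under the
pathwise flow: `X(t, t₀, ω, S(t₀, ω)) = S(t, ω)` for all `t ≥ t₀`. -/
theorem pathwiseRPS_invariant (τ : ℝ) (hτ : 0 < τ) (α : ℝ → ℝ)
    (hα : Continuous α) (hper : ∀ t : ℝ, α (t + τ) = α t)
    (hmean : 0 < ∫ u in (0:ℝ)..τ, α u)
    (ω : ℝ → ℝ) (hω : Continuous ω) (C : ℝ) (hC : 0 ≤ C)
    (hgrow : ∀ r : ℝ, |ω r| ≤ C * (1 + |r|)) :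
    ∀ t₀ t : ℝ, t₀ ≤ t →
      pathwiseFlow α t t₀ ω (pathwiseRPS α t₀ ω) = pathwiseRPS α t ω := by
  intro t₀ t ht
  have hint := integrableOn_mul_expFactor_mul hα hτ hper hmean hω hgrow t
  have hsub := intervalIntegral.integral_Iic_sub_Iic
    (hint.mono_set (Set.Iic_subset_Iic.2 ht)) hint
  have hscale : (∫ r in Set.Iic t₀, α r * expFactor α r t₀ * ω r) * expFactor α t₀ t =
      ∫ r in Set.Iic t₀, α r * expFactor α r t * ω r := by
    rw [← integral_mul_const]
    congr 1 with r
    rw [← expFactor_mul hα r t₀ t]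
    ring
  rw [pathwiseFlow, pathwiseRPS, pathwiseRPS, sub_mul, hscale, ← hsub]
  ring
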